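/- arXiv:1605.07285 — 5 statements merged into one kernel-verified Lean document; each statement's English description precedes it below -/
import Mathlib

section
/- Let k ≥ 1 and n ≥ 0 be natural numbers, and let S be a set of tuples in (Fin k → Fin n) (i.e., S ⊆ [n]^k) that is an antichain under strict domination: for all t, t' ∈ S with t ≠ t', it is not the case that t i < t' i for every coordinate i. Then the cardinality of S is at most k · n^(k−1). -/
/-- Domination Lemma: any antichain under strict domination in `[n]^k`
has at most `k * n^(k-1)` elements. -/
theorem domination_lemma (k n : ℕ) (hk : 1 ≤ k) (S : Finset (Fin k → Fin n))
    (hS : ∀ t ∈ S, ∀ t' ∈ S, t ≠ t' → ¬ (∀ i : Fin k, t i < t' i)) :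
    S.card ≤ k * n ^ (k - 1) := by
  obtain ⟨m, rfl⟩ : ∃ m, k = m + 1 := ⟨k - 1, by omega⟩
  have hmin : ∀ t : Fin (m + 1) → Fin n, ∃ i, ∀ j, t i ≤ t j := fun t => Finite.exists_min t
  choose a ha using hmin
  let F : (Fin (m + 1) → Fin n) → Fin (m + 1) × (Fin m → Fin n) := fun t =>
    (a t, fun j => ⟨(t ((a t).succAbove j) : ℕ) - (t (a t) : ℕ),
      lt_of_le_of_lt (Nat.sub_le _ _) (t _).isLt⟩)
  have key : ∀ t t', F t = F t' → ∀ j, (t j : ℕ) + t' (a t) = t' j + t (a t) := by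
    intro t t' h j
    have h1 : a t = a t' := congrArg Prod.fst h
    have h2 := congrArg Prod.snd h
    rcases Fin.eq_self_or_eq_succAbove (a t) j with hj | ⟨l, hj⟩
    · rw [hj]; omega
    · have h3 := congrArg Fin.val (congrFun h2 l)
      have h4 := ha t j
      have h5 := ha t' j
      simp only [F] at h3
      rw [← h1] at h3 h5
      rw [← hj] at h3
      rw [Fin.le_def] at h4 h5
      omega
  have hinj : Set.InjOn F S := by
    intro t ht t' ht' h
    by_contra hne
    have hk := key t t' h
    rcases lt_trichotomy (t (a t) : ℕ) (t' (a t)) with hl | hl | hl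
    · exact hS t ht t' ht' hne fun i => by
        have := hk i
        rw [Fin.lt_def]; omega
    · exact hne (funext fun i => Fin.ext (by have := hk i; omega))
    · exact hS t' ht' t ht (Ne.symm hne) fun i => by
        have := hk i
        rw [Fin.lt_def]; omega
  have := Finset.card_le_card_of_injOn (t := Finset.univ) F (fun _ _ => by simp) hinj
  simpa using this
end

section
/- Let k ≥ 1 and n ≥ 1 be natural numbers. There exists a family of at most k · n^(k−1) subsets of (Fin k → Fin n) whose union is all of (Fin k → Fin n), such that each subset in the family is a chain under strict domination: for any two distinct tuples t, t' in the same subset, either t i < t' i for every coordinate i, or t' i < t i for every coordinate i. -/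
/-- `[n]^k` can be covered by at most `k * n^(k-1)` chains under strict domination. -/
theorem chain_cover (k n : ℕ) (hk : 1 ≤ k) (hn : 1 ≤ n) :
    ∃ F : Finset (Finset (Fin k → Fin n)),
      F.card ≤ k * n ^ (k - 1) ∧
      (∀ t : Fin k → Fin n, ∃ C ∈ F, t ∈ C) ∧
      (∀ C ∈ F, ∀ t ∈ C, ∀ t' ∈ C, t ≠ t' →
        (∀ i : Fin k, t i < t' i) ∨ (∀ i : Fin k, t' i < t i)) := by
  classical
  obtain ⟨m, rfl⟩ : ∃ m, k = m + 1 := ⟨k - 1, by omega⟩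
  let D : Fin (m + 1) × (Fin m → Fin n) → Finset (Fin (m + 1) → Fin n) := fun p =>
    Finset.univ.filter fun t => ∀ j, (t (p.1.succAbove j)).val = (p.2 j).val + (t p.1).val
  refine ⟨Finset.univ.image D, ?_, ?_, ?_⟩
  · refine Finset.card_image_le.trans ?_
    simp
  · intro t
    obtain ⟨i, hi⟩ := Finite.exists_min t
    refine ⟨D (i, fun j => ⟨(t (i.succAbove j)).val - (t i).val, by omega⟩),
      Finset.mem_image_of_mem _ (Finset.mem_univ _), ?_⟩
    simp only [D, Finset.mem_filter, Finset.mem_univ, true_and]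
    intro j
    have h : (t i).val ≤ (t (i.succAbove j)).val := hi _
    omega
  · intro C hC t ht t' ht' hne
    obtain ⟨⟨i, u⟩, -, rfl⟩ := Finset.mem_image.1 hC
    simp only [D, Finset.mem_filter, Finset.mem_univ, true_and] at ht ht'
    rcases lt_trichotomy (t i) (t' i) with h | h | h
    · left
      intro l
      rcases Fin.eq_self_or_eq_succAbove i l with rfl | ⟨j, rfl⟩
      · exact h
      · rw [Fin.lt_def] at h ⊢
        rw [ht, ht']
        omega
    · exfalso
      apply hne
      funext l
      rcases Fin.eq_self_or_eq_succAbove i l with rfl | ⟨j, rfl⟩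
      · exact h
      · apply Fin.ext
        rw [ht, ht', h]
    · right
      intro l
      rcases Fin.eq_self_or_eq_succAbove i l with rfl | ⟨j, rfl⟩
      · exact h
      · rw [Fin.lt_def] at h ⊢
        rw [ht, ht']
        omega
end

section
/- Let k ≥ 1 and let m : ℕ → ℝ be monotone nondecreasing. Define a tuple x : Fin k → ℕ to be nontrivial if ∑_{i ∈ Fin k} m(x i) < 0 and 0 < ∑_{i ∈ Fin k} m(x i + 1). Then the set of nontrivial tuples is an antichain under strict domination: for any two distinct nontrivial tuples t, t', it is not the case that t i < t' i for every coordinate i. -/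
/-- The set of nontrivial tuples is an antichain under strict domination. -/
theorem nontrivial_antichain (k : ℕ) (hk : 1 ≤ k) (m : ℕ → ℝ) (hm : Monotone m)
    (t t' : Fin k → ℕ)
    (ht : (∑ i : Fin k, m (t i)) < 0 ∧ 0 < ∑ i : Fin k, m (t i + 1))
    (ht' : (∑ i : Fin k, m (t' i)) < 0 ∧ 0 < ∑ i : Fin k, m (t' i + 1))
    (hne : t ≠ t') :
    ¬ (∀ i : Fin k, t i < t' i) := by
  intro h
  have hle : ∑ i : Fin k, m (t i + 1) ≤ ∑ i : Fin k, m (t' i) :=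
    Finset.sum_le_sum fun i _ => hm (h i)
  linarith [ht.2, ht'.1]
end

section
/- Let k ≥ 1 and g ≥ 1 be natural numbers, and let m : ℕ → ℝ be monotone nondecreasing. Then the set of tuples x : Fin k → ℕ satisfying 1 ≤ x i ≤ g for every coordinate i, ∑_{i ∈ Fin k} m(x i) < 0, and 0 < ∑_{i ∈ Fin k} m(x i + 1), has cardinality at most k · g^(k−1). (This is the combinatorial core of the paper's Corollary 2: a list of n numbers divided into g sorted groups of size n/g has at most k·g^(k−1) nontrivial subproblems, i.e., k-tuples of groups whose smallest k-sum is less than zero and whose largest k-sum is greater than zero.) -/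
/-- There are at most `k * g^(k-1)` nontrivial subproblems: tuples of group indices
in `[1, g]^k` whose smallest k-sum is negative and whose largest k-sum is positive. -/
theorem nontrivial_subproblems_count (k g : ℕ) (hk : 1 ≤ k) (hg : 1 ≤ g)
    (m : ℕ → ℝ) (hm : Monotone m) :
    Set.ncard {x : Fin k → ℕ | (∀ i : Fin k, 1 ≤ x i ∧ x i ≤ g) ∧
        (∑ i : Fin k, m (x i)) < 0 ∧ 0 < ∑ i : Fin k, m (x i + 1)}
      ≤ k * g ^ (k - 1) := by
  obtain ⟨n, rfl⟩ : ∃ n, k = n + 1 := ⟨k - 1, by omega⟩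
  have hmin : ∀ x : Fin (n + 1) → ℕ, ∃ i, ∀ j, x i ≤ x j := fun x => Finite.exists_min x
  choose a ha using hmin
  let T : Finset (Fin (n + 1) × (Fin n → ℕ)) :=
    Finset.univ ×ˢ Fintype.piFinset (fun _ => Finset.range g)
  have hT : T.card = (n + 1) * g ^ (n + 1 - 1) := by
    simp [T, Finset.card_product, Fintype.card_piFinset]
  rw [← hT, ← Set.ncard_coe_finset]
  -- two nontrivial tuples cannot be strictly ordered in all coordinates
  have key : ∀ x y : Fin (n + 1) → ℕ, 0 < ∑ i, m (x i + 1) → ∑ i, m (y i) < 0 →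
      ¬ ∀ j, x j + 1 ≤ y j := by
    intro x y hx hy h
    have : ∑ i, m (x i + 1) ≤ ∑ i, m (y i) := Finset.sum_le_sum fun i _ => hm (h i)
    linarith
  refine Set.ncard_le_ncard_of_injOn
    (fun x => (a x, fun j => x ((a x).succAbove j) - x (a x))) ?_ ?_ (Finset.finite_toSet T)
  · rintro x ⟨hx, -, -⟩
    simp only [T, Finset.coe_product, Set.mem_prod, Finset.mem_coe, Finset.mem_univ, true_and,
      Fintype.mem_piFinset, Finset.mem_range]
    intro j
    have h1 := hx ((a x).succAbove j)
    have h2 := hx (a x)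
    omega
  · rintro x ⟨-, hx1, hx2⟩ y ⟨-, hy1, hy2⟩ hxy
    simp only [Prod.mk.injEq] at hxy
    obtain ⟨hi, hd⟩ := hxy
    have hax := ha x
    have hay := ha y
    rw [← hi] at hd hay
    have hsum : ∀ j, x j + y (a x) = y j + x (a x) := by
      intro j
      rcases Fin.eq_self_or_eq_succAbove (a x) j with h | ⟨l, h⟩
      · rw [h]; omega
      · have h1 := congrFun hd l
        simp only [← h] at h1
        have h2 := hax j
        have h3 := hay j
        omega
    rcases lt_trichotomy (x (a x)) (y (a x)) with h | h | h
    · exact absurd (fun j => by have := hsum j; omega) (key x y hx2 hy1)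
    · funext j
      have := hsum j
      omega
    · exact absurd (fun j => by have := hsum j; omega) (key y x hy2 hx1)
end

section
/- Let L be a list of integers and let s be a natural number with 1 ≤ s ≤ L.length. Then the s-th smallest element of L (i.e., the entry at position s−1 of L sorted in nondecreasing order) equals the least integer v such that at least s entries of L are ≤ v, i.e., it equals sInf { v : ℤ | s ≤ (L.filter (fun a => a ≤ v)).length }. (This is the correctness invariant of the paper's bounded-range s-Select binary-search algorithm: the algorithm returns the smallest integer v such that there are s values less than or equal to v, and since all values are integers this is the s-th smallest value.) -/
theorem sorted_getElem_le_iff (v : ℤ) (M : List ℤ) (hM : M.Pairwise (· ≤ ·)) (k : ℕ)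
    (hk : k < M.length) : M[k] ≤ v ↔ k + 1 ≤ (M.filter (fun a => a ≤ v)).length := by
  induction M generalizing k with
  | nil => simp at hk
  | cons a M ih =>
    rw [List.pairwise_cons] at hM
    obtain ⟨ha, hM⟩ := hM
    by_cases hav : a ≤ v
    · cases k with
      | zero => simp [hav]
      | succ k =>
        have := ih hM k (by simpa using hk)
        simp [hav, this]
    · have hnil : M.filter (fun a => a ≤ v) = [] := by
        rw [List.filter_eq_nil_iff]
        intro b hb
        have := ha b hb
        simp
        omega
      rw [List.filter_cons_of_neg (by simpa using hav), hnil]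
      cases k with
      | zero => simpa using hav
      | succ k =>
        have hk' : k < M.length := by simpa using hk
        have := ha M[k] (List.getElem_mem hk')
        simp
        omega

/-- The `s`-th smallest element of a list of integers equals the least integer `v`
such that at least `s` entries of the list are `≤ v`. -/
theorem sSelect_eq_sInf (L : List ℤ) (s : ℕ) (h1 : 1 ≤ s) (h2 : s ≤ L.length) :
    (L.insertionSort (· ≤ ·))[s - 1]'(by
        rw [List.length_insertionSort]; omega)
      = sInf {v : ℤ | s ≤ (L.filter (fun a => a ≤ v)).length} := by
  have hlen : s - 1 < (L.insertionSort (· ≤ ·)).length := by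
    rw [List.length_insertionSort]; omega
  have hset : {v : ℤ | s ≤ (L.filter (fun a => a ≤ v)).length}
      = Set.Ici ((L.insertionSort (· ≤ ·))[s - 1]'hlen) := by
    ext v
    have h := sorted_getElem_le_iff v _ (List.pairwise_insertionSort (· ≤ ·) L) (s - 1) hlen
    rw [((List.perm_insertionSort (· ≤ ·) L).filter _).length_eq, Nat.sub_add_cancel h1] at h
    exact h.symm
  rw [hset, csInf_Ici]
end
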